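/- The branching-process prior is a probability distribution on context trees: for every λ ∈ [0,1] and every D ≥ 0, Σ_{T ∈ 𝒯(D)} (1−λ)^{(|ℒ(T)|−1)/(A−1)} · λ^{|ℒ(T)|−|ℒ_D(T)|} = 1. -/

import Mathlib

open scoped Classical

noncomputable section

variable {𝒜 : Type*}

/-- The finset of all strings over `𝒜` of length at most `D`. -/
def stringsLe (𝒜 : Type*) [Fintype 𝒜] (D : ℕ) : Finset (List 𝒜) :=
  Set.Finite.toFinset (List.finite_length_le 𝒜 D)

/-- A context tree of maximum depth `D`, identified with its leaf set: every leaf has length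
at most `D`, no leaf is a (proper) suffix of another, and every string of length `D` has
exactly one suffix among the leaves. -/
def IsContextTree (D : ℕ) (T : Finset (List 𝒜)) : Prop :=
  (∀ s ∈ T, s.length ≤ D) ∧
  (∀ s ∈ T, ∀ t ∈ T, s <:+ t → s = t) ∧
  (∀ w : List 𝒜, w.length = D → ∃! s, s ∈ T ∧ s <:+ w)

/-- The finset of all context trees of maximum depth `D`. -/
def contextTrees (𝒜 : Type*) [Fintype 𝒜] (D : ℕ) : Finset (Finset (List 𝒜)) :=
  (stringsLe 𝒜 D).powerset.filter (IsContextTree D)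

/-- The branching-process prior `π_D` on context trees. -/
def priorD [Fintype 𝒜] (lam : ℝ) (D : ℕ) (T : Finset (List 𝒜)) : ℝ :=
  (1 - lam) ^ ((T.card - 1) / (Fintype.card 𝒜 - 1)) *
    lam ^ (T.card - (T.filter (fun s => s.length = D)).card)

/-- The window `(x_{1-D}, …, x_{j-1})`. -/
def window (x : ℤ → 𝒜) (D : ℕ) (j : ℕ) : List 𝒜 :=
  (List.range (D + j - 1)).map (fun i => x (1 - (D : ℤ) + (i : ℤ)))

/-- The counting vector `𝐧_{n,s}(a)`. -/
def cnt [DecidableEq 𝒜] (x : ℤ → 𝒜) (D n : ℕ) (s : List 𝒜) (a : 𝒜) : ℕ :=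
  ((Finset.Icc 1 n).filter (fun (j : ℕ) => x (j : ℤ) = a ∧ s <:+ window x D j)).card

/-- The evidence value `P^e(m)` of a counting vector `m` under Dirichlet parameters `α`. -/
def pEv [Fintype 𝒜] (α : 𝒜 → ℝ) (m : 𝒜 → ℕ) : ℝ :=
  (Real.Gamma (∑ a, α a) / Real.Gamma (∑ a, ((m a : ℝ) + α a))) *
    ∏ a, (Real.Gamma ((m a : ℝ) + α a) / Real.Gamma (α a))

/-- The evidence `p^e_{n,s}`. -/
def pE [Fintype 𝒜] [DecidableEq 𝒜] (α : 𝒜 → ℝ) (x : ℤ → 𝒜) (D n : ℕ) (s : List 𝒜) : ℝ :=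
  pEv α (cnt x D n s)

/-- Auxiliary downward recursion for the CTW weighted probabilities, with fuel `k = D - |s|`. -/
def pWaux [Fintype 𝒜] [DecidableEq 𝒜] (α : 𝒜 → ℝ) (lam : ℝ) (x : ℤ → 𝒜) (D n : ℕ) :
    ℕ → List 𝒜 → ℝ
  | 0, s => pE α x D n s
  | k + 1, s => lam * pE α x D n s + (1 - lam) * ∏ q, pWaux α lam x D n k (q :: s)

/-- The CTW weighted probability `p^w_{n,s}`. -/
def pW [Fintype 𝒜] [DecidableEq 𝒜] (α : 𝒜 → ℝ) (lam : ℝ) (x : ℤ → 𝒜) (D n : ℕ)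
    (s : List 𝒜) : ℝ :=
  pWaux α lam x D n (D - s.length) s

/-- The observed suffix `s_{n,l} = (x_{n-l+1}, …, x_n)` of length `l`. -/
def sfx (x : ℤ → 𝒜) (n : ℤ) (l : ℕ) : List 𝒜 :=
  (List.range l).map (fun i => x (n - (l : ℤ) + 1 + (i : ℤ)))

/-- The CTW mixture weight `ω_{n,l}`. -/
def omegaW [Fintype 𝒜] [DecidableEq 𝒜] (α : 𝒜 → ℝ) (lam : ℝ) (x : ℤ → 𝒜) (D n l : ℕ) : ℝ :=
  (∑ T ∈ (contextTrees 𝒜 D).filter (fun T => sfx x n l ∈ T),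
      priorD lam D T * ∏ s ∈ T, pE α x D n s) / pW α lam x D n []

/-- The per-suffix Bayesian predictor `p̄_{n,s}(a)`. -/
def pBar [Fintype 𝒜] [DecidableEq 𝒜] (α : 𝒜 → ℝ) (x : ℤ → 𝒜) (D n : ℕ) (s : List 𝒜)
    (a : 𝒜) : ℝ :=
  (α a + cnt x D n s a) / ∑ q, (α q + cnt x D n s q)

end

section ContextTreeRecursion

open Finset

variable {𝒜 : Type*}

theorem append_singleton_suffix_append_singleton {s t : List 𝒜} {a b : 𝒜} :
    s ++ [a] <:+ t ++ [b] ↔ a = b ∧ s <:+ t := by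
  rw [← List.reverse_prefix, ← List.reverse_prefix (l₁ := s)]
  simp [List.cons_prefix_cons]

theorem isContextTree_singleton_nil (D : ℕ) : IsContextTree D ({[]} : Finset (List 𝒜)) := by
  refine ⟨by simp, by simp, fun w _ => ⟨[], by simp, ?_⟩⟩
  rintro s ⟨hs, -⟩
  simpa using hs

theorem IsContextTree.eq_singleton_nil {D : ℕ} {T : Finset (List 𝒜)} (hT : IsContextTree D T)
    (h : [] ∈ T) : T = {[]} :=
  eq_singleton_iff_unique_mem.2
    ⟨h, fun s hs => (hT.2.1 [] h s hs List.nil_suffix).symm⟩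

theorem card_sub_card_filter_length (D : ℕ) (T : Finset (List 𝒜)) :
    T.card - (T.filter (fun s => s.length = D)).card =
      ∑ s ∈ T, if s.length = D then 0 else 1 := by
  rw [← card_filter_add_card_filter_not (s := T) (fun s => s.length = D), Nat.add_sub_cancel_left,
    card_filter]
  simp only [ite_not]

variable [Fintype 𝒜]

theorem mem_contextTrees {D : ℕ} {T : Finset (List 𝒜)} :
    T ∈ contextTrees 𝒜 D ↔ IsContextTree D T := by
  simp only [contextTrees, stringsLe, mem_filter, mem_powerset, and_iff_right_iff_imp]
  intro h s hs
  simpa using h.1 s hs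

/-- The leaf set of the tree whose root has the trees `F a` as its children. -/
noncomputable def joinTrees (F : 𝒜 → Finset (List 𝒜)) : Finset (List 𝒜) :=
  univ.biUnion fun a => (F a).image (· ++ [a])

theorem append_singleton_mem_joinTrees {F : 𝒜 → Finset (List 𝒜)} {s : List 𝒜} {a : 𝒜} :
    s ++ [a] ∈ joinTrees F ↔ s ∈ F a := by
  simp only [joinTrees, mem_biUnion, mem_univ, true_and, mem_image]
  constructor
  · rintro ⟨b, t, ht, h⟩
    obtain ⟨rfl, h'⟩ := List.append_inj' h rfl
    obtain rfl : b = a := by simpa using h'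
    exact ht
  · exact fun h => ⟨a, s, h, rfl⟩

theorem nil_notMem_joinTrees (F : 𝒜 → Finset (List 𝒜)) : [] ∉ joinTrees F := by
  simp [joinTrees]

theorem joinTrees_injective : Function.Injective (joinTrees (𝒜 := 𝒜)) := by
  intro F G h
  ext a s
  rw [← append_singleton_mem_joinTrees, h, append_singleton_mem_joinTrees]

theorem exists_joinTrees_eq {T : Finset (List 𝒜)} (hT : [] ∉ T) :
    ∃ F : 𝒜 → Finset (List 𝒜), joinTrees F = T := by
  refine ⟨fun a => T.preimage (· ++ [a]) (List.append_left_injective [a]).injOn, ?_⟩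
  ext s
  induction s using List.reverseRecOn with
  | nil => simp [nil_notMem_joinTrees, hT]
  | append_singleton s a => rw [append_singleton_mem_joinTrees, mem_preimage]

theorem sum_joinTrees {M : Type*} [AddCommMonoid M] (F : 𝒜 → Finset (List 𝒜))
    (g : List 𝒜 → M) :
    ∑ s ∈ joinTrees F, g s = ∑ a, ∑ s ∈ F a, g (s ++ [a]) := by
  rw [joinTrees, sum_biUnion]
  · exact sum_congr rfl fun a _ => sum_image fun _ _ _ _ h => List.append_cancel_right h
  · intro a _ b _ hab
    refine disjoint_left.2 fun s hs ht => hab ?_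
    obtain ⟨u, -, rfl⟩ := mem_image.1 hs
    obtain ⟨v, -, h⟩ := mem_image.1 ht
    simpa using (List.append_inj' h rfl).2.symm

theorem isContextTree_joinTrees {D : ℕ} {F : 𝒜 → Finset (List 𝒜)} :
    IsContextTree (D + 1) (joinTrees F) ↔ ∀ a, IsContextTree D (F a) := by
  constructor
  · rintro ⟨hlen, hsuff, hcover⟩ a
    refine ⟨fun s hs => ?_, fun s hs t ht hst => ?_, fun w hw => ?_⟩
    · simpa using hlen _ (append_singleton_mem_joinTrees.2 hs)
    · exact List.append_cancel_right <| hsuff _ (append_singleton_mem_joinTrees.2 hs) _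
        (append_singleton_mem_joinTrees.2 ht)
        (append_singleton_suffix_append_singleton.2 ⟨rfl, hst⟩)
    · obtain ⟨u, ⟨hu, huw⟩, huniq⟩ := hcover (w ++ [a]) (by simp [hw])
      induction u using List.reverseRecOn with
      | nil => exact absurd hu (nil_notMem_joinTrees F)
      | append_singleton s b =>
        obtain ⟨rfl, hsw⟩ := append_singleton_suffix_append_singleton.1 huw
        refine ⟨s, ⟨append_singleton_mem_joinTrees.1 hu, hsw⟩, fun t ht => ?_⟩
        exact List.append_cancel_right <| huniq (t ++ [b])
          ⟨append_singleton_mem_joinTrees.2 ht.1,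
            append_singleton_suffix_append_singleton.2 ⟨rfl, ht.2⟩⟩
  · intro h
    refine ⟨fun u hu => ?_, fun u hu v hv huv => ?_, fun w hw => ?_⟩
    · induction u using List.reverseRecOn with
      | nil => simp
      | append_singleton s a =>
        simpa using (h a).1 s (append_singleton_mem_joinTrees.1 hu)
    · induction u using List.reverseRecOn with
      | nil => exact absurd hu (nil_notMem_joinTrees F)
      | append_singleton s a =>
        induction v using List.reverseRecOn with
        | nil => exact absurd hv (nil_notMem_joinTrees F)
        | append_singleton t b =>
          obtain ⟨rfl, hst⟩ := append_singleton_suffix_append_singleton.1 huv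
          rw [(h a).2.1 s (append_singleton_mem_joinTrees.1 hu) t
            (append_singleton_mem_joinTrees.1 hv) hst]
    · induction w using List.reverseRecOn with
      | nil => simp at hw
      | append_singleton w a =>
        obtain ⟨s, ⟨hs, hsw⟩, huniq⟩ := (h a).2.2 w (by simpa using hw)
        refine ⟨s ++ [a], ⟨append_singleton_mem_joinTrees.2 hs,
          append_singleton_suffix_append_singleton.2 ⟨rfl, hsw⟩⟩, ?_⟩
        rintro u ⟨hu, huw⟩
        induction u using List.reverseRecOn with
        | nil => exact absurd hu (nil_notMem_joinTrees F)
        | append_singleton t b =>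
          obtain ⟨rfl, htw⟩ := append_singleton_suffix_append_singleton.1 huw
          rw [huniq t ⟨append_singleton_mem_joinTrees.1 hu, htw⟩]

theorem contextTrees_zero : contextTrees 𝒜 0 = {{[]}} := by
  ext T
  rw [mem_contextTrees, mem_singleton]
  constructor
  · intro hT
    obtain ⟨s, ⟨hs, hs'⟩, -⟩ := hT.2.2 [] rfl
    exact hT.eq_singleton_nil (List.suffix_nil.1 hs' ▸ hs)
  · rintro rfl
    exact isContextTree_singleton_nil 0

theorem contextTrees_succ (D : ℕ) :
    contextTrees 𝒜 (D + 1) =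
      insert {[]} ((Fintype.piFinset fun _ : 𝒜 => contextTrees 𝒜 D).image joinTrees) := by
  ext T
  simp only [mem_contextTrees, mem_insert, mem_image, Fintype.mem_piFinset]
  constructor
  · intro hT
    by_cases h : [] ∈ T
    · exact Or.inl (hT.eq_singleton_nil h)
    · obtain ⟨F, rfl⟩ := exists_joinTrees_eq h
      exact Or.inr ⟨F, isContextTree_joinTrees.1 hT, rfl⟩
  · rintro (rfl | ⟨F, hF, rfl⟩)
    · exact isContextTree_singleton_nil _
    · exact isContextTree_joinTrees.2 hF

theorem card_joinTrees (F : 𝒜 → Finset (List 𝒜)) :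
    (joinTrees F).card = ∑ a, (F a).card := by
  simp only [card_eq_sum_ones, sum_joinTrees]

theorem card_joinTrees_of_card_eq (hA : 2 ≤ Fintype.card 𝒜) {F : 𝒜 → Finset (List 𝒜)}
    {k : 𝒜 → ℕ} (hk : ∀ a, (F a).card = k a * (Fintype.card 𝒜 - 1) + 1) :
    (joinTrees F).card = (∑ a, k a + 1) * (Fintype.card 𝒜 - 1) + 1 := by
  rw [card_joinTrees, sum_congr rfl fun a _ => hk a, sum_add_distrib, ← sum_mul]
  simp only [sum_const, card_univ, smul_eq_mul, mul_one, add_mul, one_mul]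
  omega

/-- The number of leaves of a context tree is congruent to `1` modulo `|𝒜| - 1`. -/
theorem IsContextTree.exists_card_eq (hA : 2 ≤ Fintype.card 𝒜) {D : ℕ} {T : Finset (List 𝒜)}
    (hT : IsContextTree D T) : ∃ k, T.card = k * (Fintype.card 𝒜 - 1) + 1 := by
  induction D generalizing T with
  | zero =>
    rw [← mem_contextTrees, contextTrees_zero, mem_singleton] at hT
    exact ⟨0, by simp [hT]⟩
  | succ D ih =>
    by_cases h : [] ∈ T
    · exact ⟨0, by simp [hT.eq_singleton_nil h]⟩
    · obtain ⟨F, rfl⟩ := exists_joinTrees_eq h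
      choose k hk using fun a => ih (isContextTree_joinTrees.1 hT a)
      exact ⟨_, card_joinTrees_of_card_eq hA hk⟩

theorem priorD_of_card_eq (hA : 2 ≤ Fintype.card 𝒜) (lam : ℝ) (D : ℕ) {T : Finset (List 𝒜)}
    {k : ℕ} (hk : T.card = k * (Fintype.card 𝒜 - 1) + 1) :
    priorD lam D T = (1 - lam) ^ k * lam ^ ∑ s ∈ T, if s.length = D then 0 else 1 := by
  rw [priorD, card_sub_card_filter_length, hk, Nat.add_sub_cancel,
    Nat.mul_div_cancel _ (by omega)]

theorem priorD_joinTrees (hA : 2 ≤ Fintype.card 𝒜) (lam : ℝ) {D : ℕ}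
    {F : 𝒜 → Finset (List 𝒜)} (hF : ∀ a, IsContextTree D (F a)) :
    priorD lam (D + 1) (joinTrees F) = (1 - lam) * ∏ a, priorD lam D (F a) := by
  choose k hk using fun a => (hF a).exists_card_eq hA
  rw [priorD_of_card_eq hA lam _ (card_joinTrees_of_card_eq hA hk),
    prod_congr rfl fun a _ => priorD_of_card_eq hA lam D (hk a), prod_mul_distrib,
    prod_pow_eq_pow_sum, prod_pow_eq_pow_sum, sum_joinTrees, pow_succ']
  simp [mul_assoc]

theorem priorD_zero_singleton_nil (lam : ℝ) : priorD lam 0 ({[]} : Finset (List 𝒜)) = 1 := by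
  simp [priorD, filter_singleton]

theorem priorD_succ_singleton_nil (lam : ℝ) (D : ℕ) :
    priorD lam (D + 1) ({[]} : Finset (List 𝒜)) = lam := by
  simp [priorD, filter_singleton]

theorem sum_priorD_succ (hA : 2 ≤ Fintype.card 𝒜) (lam : ℝ) (D : ℕ) :
    ∑ T ∈ contextTrees 𝒜 (D + 1), priorD lam (D + 1) T =
      lam + (1 - lam) * (∑ T ∈ contextTrees 𝒜 D, priorD lam D T) ^ Fintype.card 𝒜 := by
  rw [contextTrees_succ, sum_insert, sum_image joinTrees_injective.injOn,
    priorD_succ_singleton_nil]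
  · rw [← card_univ, ← prod_const, prod_univ_sum, mul_sum]
    congr 1
    refine sum_congr rfl fun F hF => priorD_joinTrees hA lam fun a => ?_
    exact mem_contextTrees.1 (Fintype.mem_piFinset.1 hF a)
  · intro h
    obtain ⟨F, -, hF⟩ := mem_image.1 h
    exact nil_notMem_joinTrees F (hF ▸ mem_singleton_self [])

end ContextTreeRecursion

/-- The branching-process prior is a probability distribution on the set of
context trees of maximum depth `D`: the priors sum to one. -/
theorem priorD_sums_to_one {𝒜 : Type*} [Fintype 𝒜] [DecidableEq 𝒜]
    (hA : 2 ≤ Fintype.card 𝒜) (D : ℕ) (lam : ℝ) (hlam : lam ∈ Set.Icc (0 : ℝ) 1) :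
    ∑ T ∈ contextTrees 𝒜 D, priorD lam D T = 1 := by
  induction D with
  | zero => rw [contextTrees_zero, Finset.sum_singleton, priorD_zero_singleton_nil]
  | succ D ih => rw [sum_priorD_succ hA, ih, one_pow, mul_one, add_sub_cancel]
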